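/- For n ≥ 2, the polynomial T_n(t) = Σ_k a_k(n) t^k is divisible by (1+t)^{⌊n/2⌋}. -/

import Mathlib

/-- The list of values of a permutation of `Fin n` (0-indexed; relative order
is what matters). -/
def permList (n : ℕ) (w : Equiv.Perm (Fin n)) : List ℕ :=
  List.ofFn (fun i => (w i : ℕ))

/-- A list is alternating: `a > b < c > d < ⋯` (descents in even positions). -/
def IsAlt (l : List ℕ) : Prop :=
  ∀ i : ℕ, ∀ hi : i + 1 < l.length,
    if i % 2 = 0 then l.get ⟨i + 1, hi⟩ < l.get ⟨i, Nat.lt_of_succ_lt hi⟩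
    else l.get ⟨i, Nat.lt_of_succ_lt hi⟩ < l.get ⟨i + 1, hi⟩

/-- `asLen n w` : the maximum length of an alternating subsequence of `w`. -/
noncomputable def asLen (n : ℕ) (w : Equiv.Perm (Fin n)) : ℕ :=
  sSup {k | ∃ l : List ℕ, l.Sublist (permList n w) ∧ IsAlt l ∧ l.length = k}

/-- `aCount n k = #{w ∈ S_n : as(w) = k}`. -/
noncomputable def aCount (n k : ℕ) : ℕ :=
  Nat.card {w : Equiv.Perm (Fin n) // asLen n w = k}

/-- `bCount n k = #{w ∈ S_n : as(w) ≤ k}`. -/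
noncomputable def bCount (n k : ℕ) : ℕ :=
  Nat.card {w : Equiv.Perm (Fin n) // asLen n w ≤ k}

/-! ### Alternating subsequences and the greedy statistic -/

/-- `y` lies strictly below `x` if `d = true`, strictly above `x` if `d = false`. -/
def StepsTo (d : Bool) (x y : ℕ) : Prop := if d then y < x else x < y

instance (d : Bool) (x y : ℕ) : Decidable (StepsTo d x y) := by
  unfold StepsTo; infer_instance

/-- Lists that alternate strictly, the first step being a descent iff `d = true`. -/
def AltFrom : Bool → List ℕ → Prop
  | _, [] => True
  | _, [_] => True
  | d, x :: y :: l => StepsTo d x y ∧ AltFrom (!d) (y :: l)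

/-- The number of monotone runs of a list, where a phantom step opposite to `d` precedes it. -/
def runCount : Bool → List ℕ → ℕ
  | _, [] => 0
  | _, [_] => 1
  | d, x :: y :: l =>
      if StepsTo d x y then runCount (!d) (y :: l) + 1 else runCount d (y :: l)

theorem altFrom_iff (d : Bool) (l : List ℕ) :
    AltFrom d l ↔ ∀ i : ℕ, ∀ hi : i + 1 < l.length,
      StepsTo (if i % 2 = 0 then d else !d) l[i] l[i + 1] := by
  induction l generalizing d with
  | nil => simp [AltFrom]
  | cons x l ih =>
    cases l with
    | nil => simp [AltFrom]
    | cons y l =>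
      rw [AltFrom, ih]
      constructor
      · rintro ⟨h0, h⟩ (_ | i) hi
        · simpa using h0
        · have := h i (by simpa using hi)
          rcases Nat.mod_two_eq_zero_or_one i with h2 | h2
          · have h3 : (i + 1) % 2 = 1 := by omega
            simpa [h2, h3] using this
          · have h3 : (i + 1) % 2 = 0 := by omega
            simpa [h2, h3] using this
      · intro h
        refine ⟨by simpa using h 0 (by simp), fun i hi => ?_⟩
        have := h (i + 1) (by simpa using hi)
        rcases Nat.mod_two_eq_zero_or_one i with h2 | h2
        · have h3 : (i + 1) % 2 = 1 := by omega
          simpa [h2, h3] using this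
        · have h3 : (i + 1) % 2 = 0 := by omega
          simpa [h2, h3] using this

theorem isAlt_iff_altFrom (l : List ℕ) : IsAlt l ↔ AltFrom true l := by
  rw [altFrom_iff, IsAlt]
  refine forall_congr' fun i => forall_congr' fun hi => ?_
  split_ifs <;> simp [StepsTo]

theorem runCount_le_not_add_one (d : Bool) (l : List ℕ) :
    runCount d l ≤ runCount (!d) l + 1 := by
  induction l generalizing d with
  | nil => simp [runCount]
  | cons x l ih =>
    cases l with
    | nil => simp [runCount]
    | cons y l =>
      have h1 := ih d
      have h2 := ih (!d)
      have h3 : ¬ (StepsTo d x y ∧ StepsTo (!d) x y) := by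
        cases d <;> simp [StepsTo] <;> omega
      simp only [runCount, Bool.not_not] at *
      split_ifs <;> omega

theorem runCount_pos (d : Bool) (x : ℕ) (l : List ℕ) : 0 < runCount d (x :: l) := by
  induction l generalizing d x with
  | nil => simp [runCount]
  | cons y l ih =>
    rw [runCount]
    split_ifs
    · omega
    · exact ih d y

theorem length_le_runCount (d : Bool) (l s : List ℕ) (hs : s.Sublist l) (h : AltFrom d s) :
    s.length ≤ runCount d l := by
  induction l generalizing d s with
  | nil => simp_all
  | cons x l ih =>
    cases l with
    | nil => simpa [runCount] using hs.length_le
    | cons y l =>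
      have tail_case : ∀ s' : List ℕ, s'.Sublist (y :: l) → AltFrom d s' →
          s'.length ≤ runCount d (x :: y :: l) := by
        intro s' h1 h2
        have h3 := ih d s' h1 h2
        have h4 := runCount_le_not_add_one d (y :: l)
        rw [runCount]
        split_ifs <;> omega
      rcases List.sublist_cons_iff.1 hs with hs | ⟨s', rfl, hs'⟩
      · exact tail_case s hs h
      · cases s' with
        | nil => exact runCount_pos _ _ _
        | cons z s' =>
          obtain ⟨hz, hz'⟩ := h
          by_cases hxy : StepsTo d x y
          · have := ih (!d) _ hs' hz'
            rw [runCount, if_pos hxy]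
            simpa using this
          · rcases List.sublist_cons_iff.1 hs' with hs' | ⟨s'', hs'', -⟩
            · refine tail_case (y :: z :: s') (hs'.cons_cons y) ⟨?_, hz'⟩
              cases d <;> simp [StepsTo] at * <;> omega
            · obtain ⟨rfl, -⟩ := List.cons.inj hs''
              exact absurd hz hxy

theorem exists_altFrom_sublist (d : Bool) (x : ℕ) (l : List ℕ) :
    ∃ (z : ℕ) (s : List ℕ), (z :: s).Sublist (x :: l) ∧ AltFrom d (z :: s) ∧
      (z :: s).length = runCount d (x :: l) ∧ ¬ StepsTo d x z := by
  induction l generalizing d x with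
  | nil => exact ⟨x, [], by simp, trivial, rfl, by cases d <;> simp [StepsTo]⟩
  | cons y l ih =>
    by_cases hxy : StepsTo d x y
    · obtain ⟨z, s, h1, h2, h3, h4⟩ := ih (!d) y
      refine ⟨x, z :: s, h1.cons_cons x, ⟨?_, h2⟩, ?_, ?_⟩
      · cases d <;> simp [StepsTo] at * <;> omega
      · rw [runCount, if_pos hxy, ← h3, List.length_cons]
      · cases d <;> simp [StepsTo]
    · obtain ⟨z, s, h1, h2, h3, h4⟩ := ih d y
      refine ⟨z, s, h1.cons x, h2, ?_, ?_⟩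
      · rw [runCount, if_neg hxy, ← h3]
      · cases d <;> simp [StepsTo] at * <;> omega

theorem asLen_eq_runCount (n : ℕ) (w : Equiv.Perm (Fin n)) :
    asLen n w = runCount true (permList n w) := by
  refine IsGreatest.csSup_eq ⟨?_, ?_⟩
  · cases h : permList n w with
    | nil => exact ⟨[], by simp, (isAlt_iff_altFrom _).2 trivial, rfl⟩
    | cons x l =>
      obtain ⟨z, s, h1, h2, h3, -⟩ := exists_altFrom_sublist true x l
      exact ⟨z :: s, h1, (isAlt_iff_altFrom _).2 h2, h3⟩
  · rintro k ⟨s, h1, h2, rfl⟩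
    exact length_le_runCount true _ s h1 ((isAlt_iff_altFrom _).1 h2)

theorem runCount_map (d : Bool) (f : ℕ → ℕ) (hf : StrictMono f) (l : List ℕ) :
    runCount d (l.map f) = runCount d l := by
  induction l generalizing d with
  | nil => rfl
  | cons x l ih =>
    cases l with
    | nil => rfl
    | cons y l =>
      have h : StepsTo d (f x) (f y) ↔ StepsTo d x y := by
        cases d <;> simp [StepsTo, hf.lt_iff_lt]
      have h1 := ih d
      have h2 := ih (!d)
      simp only [List.map_cons] at h1 h2
      simp only [List.map_cons, runCount, h, h1, h2]

theorem runCount_le_length (d : Bool) (l : List ℕ) : runCount d l ≤ l.length := by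
  cases l with
  | nil => rfl
  | cons x l =>
    obtain ⟨z, s, h1, -, h3, -⟩ := exists_altFrom_sublist d x l
    exact h3 ▸ h1.length_le

/-! ### Prepending a value to a permutation -/

/-- The permutation with first value `a` whose remaining values are order isomorphic to `σ`. -/
def permCons {n : ℕ} (a : Fin (n + 1)) (σ : Equiv.Perm (Fin n)) : Equiv.Perm (Fin (n + 1)) :=
  (finSuccEquiv n).trans ((Equiv.optionCongr σ).trans (finSuccEquiv' a).symm)

theorem permCons_zero {n : ℕ} (a : Fin (n + 1)) (σ : Equiv.Perm (Fin n)) :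
    permCons a σ 0 = a := by
  simp [permCons]

theorem permCons_succ {n : ℕ} (a : Fin (n + 1)) (σ : Equiv.Perm (Fin n)) (i : Fin n) :
    permCons a σ i.succ = a.succAbove (σ i) := by
  simp [permCons]

theorem permCons_bijective (n : ℕ) :
    Function.Bijective
      (fun p : Fin (n + 1) × Equiv.Perm (Fin n) => permCons p.1 p.2) := by
  rw [Fintype.bijective_iff_injective_and_card]
  constructor
  · rintro ⟨a, σ⟩ ⟨b, τ⟩ h
    have h0 := DFunLike.congr_fun h 0
    simp only [permCons_zero] at h0
    subst h0
    refine Prod.ext rfl (Equiv.ext fun i => ?_)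
    have hi := DFunLike.congr_fun h i.succ
    simpa only [permCons_succ, Fin.succAbove_right_inj] using hi
  · simp [Fintype.card_perm, Nat.factorial_succ]

theorem sum_perm_succ {M : Type*} [AddCommMonoid M] (n : ℕ)
    (F : Equiv.Perm (Fin (n + 1)) → M) :
    ∑ w, F w = ∑ a, ∑ σ, F (permCons a σ) := by
  rw [← (permCons_bijective n).sum_comp, Fintype.sum_prod_type]

theorem permList_permCons {n : ℕ} (a : Fin (n + 1)) (σ : Equiv.Perm (Fin n)) :
    permList (n + 1) (permCons a σ) =
      (a : ℕ) :: (permList n σ).map (fun v => if v < (a : ℕ) then v else v + 1) := by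
  rw [permList, List.ofFn_succ, permCons_zero, permList, List.map_ofFn]
  congr 2
  funext i
  simp only [permCons_succ, Fin.succAbove, Function.comp, Fin.lt_def, Fin.val_castSucc]
  split_ifs <;> simp

theorem strictMono_skip (a : ℕ) : StrictMono (fun v : ℕ => if v < a then v else v + 1) := by
  intro x y h
  dsimp only
  split_ifs <;> omega

theorem runCount_permCons_permCons (d : Bool) {n : ℕ} (a : Fin (n + 2)) (b : Fin (n + 1))
    (σ : Equiv.Perm (Fin n)) :
    runCount d (permList (n + 2) (permCons a (permCons b σ))) =
      if (if d then (b : ℕ) < a else (a : ℕ) ≤ b) then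
        runCount (!d) (permList (n + 1) (permCons b σ)) + 1
      else runCount d (permList (n + 1) (permCons b σ)) := by
  have key := fun d => runCount_map d _ (strictMono_skip a) (permList (n + 1) (permCons b σ))
  have h : StepsTo d a (if (b : ℕ) < a then (b : ℕ) else b + 1) ↔
      (if d then (b : ℕ) < a else (a : ℕ) ≤ b) := by
    cases d <;> simp only [StepsTo, if_true, if_false, Bool.false_eq_true] <;> split_ifs <;> omega
  rw [permList_permCons a]
  rw [permList_permCons b] at key ⊢
  simp only [List.map_cons] at key ⊢
  simp only [runCount, key, h]

/-! ### The generating function refined by the first value -/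

open Polynomial in
/-- The generating polynomial of `runCount d` over permutations of `Fin (n + 1)` with first
value `a`. -/
noncomputable def runPoly : Bool → ℕ → ℕ → ℤ[X]
  | _, 0, _ => X
  | d, n + 1, a => ∑ b ∈ Finset.range (n + 1),
      if (if d then b < a else a ≤ b) then X * runPoly (!d) n b else runPoly d n b

open Polynomial in
theorem sum_pow_runCount_permCons (d : Bool) (n : ℕ) (a : Fin (n + 1)) :
    ∑ σ : Equiv.Perm (Fin n), (X : ℤ[X]) ^ runCount d (permList (n + 1) (permCons a σ)) =
      runPoly d n a := by
  induction n generalizing d with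
  | zero => simp [runPoly, permList, runCount]
  | succ n ih =>
    rw [sum_perm_succ, runPoly, ← Fin.sum_univ_eq_sum_range
      (fun b => if (if d then b < (a : ℕ) else (a : ℕ) ≤ b) then X * runPoly (!d) n b
        else runPoly d n b)]
    refine Finset.sum_congr rfl fun b _ => ?_
    simp only [runCount_permCons_permCons]
    rw [← ih, ← ih, Finset.mul_sum]
    by_cases h : (if d then (b : ℕ) < a else (a : ℕ) ≤ b)
    · simp only [if_pos h, pow_succ']
    · simp only [if_neg h]

open Polynomial in
theorem sum_aCount_eq_sum_runPoly (n : ℕ) :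
    ∑ k ∈ Finset.range (n + 1 + 1), C (aCount (n + 1) k : ℤ) * X ^ k =
      ∑ a ∈ Finset.range (n + 1), runPoly true n a := by
  classical
  rw [← Fin.sum_univ_eq_sum_range (runPoly true n)]
  simp only [← sum_pow_runCount_permCons]
  rw [← sum_perm_succ n (fun w => (X : ℤ[X]) ^ runCount true (permList (n + 1) w))]
  simp only [← asLen_eq_runCount]
  rw [← Finset.sum_fiberwise_of_maps_to (s := Finset.univ) (t := Finset.range (n + 1 + 1))
    (g := asLen (n + 1))]
  · refine Finset.sum_congr rfl fun k _ => ?_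
    rw [Finset.sum_congr rfl (g := fun _ => (X : ℤ[X]) ^ k)
      (fun w hw => by rw [(Finset.mem_filter.1 hw).2])]
    rw [Finset.sum_const, aCount, Nat.card_eq_fintype_card, Fintype.card_subtype]
    simp
  · intro w _
    rw [Finset.mem_range, asLen_eq_runCount, Nat.lt_succ_iff]
    simpa [permList] using runCount_le_length true (permList (n + 1) w)

theorem runPoly_not (d : Bool) (n a : ℕ) (ha : a ≤ n) :
    runPoly (!d) n a = runPoly d n (n - a) := by
  induction n generalizing d a with
  | zero => simp [runPoly]
  | succ n ih =>
    rw [runPoly, runPoly, ← Finset.sum_range_reflect]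
    refine Finset.sum_congr rfl fun b hb => ?_
    have hb := Finset.mem_range.1 hb
    have h1 : n + 1 - 1 - b = n - b := by omega
    have h2 : n - (n - b) = b := by omega
    have h3 := ih d (n - b) (by omega)
    have h4 := ih (!d) (n - b) (by omega)
    rw [h2] at h3 h4
    rw [h1, h3, h4]
    have h5 : (if !d then n - b < a else a ≤ n - b) ↔
        (if d then b < n + 1 - a else n + 1 - a ≤ b) := by
      cases d <;> simp <;> omega
    simp only [h5]

/-! ### Divisibility by powers of `1 + t` -/

section Divisibility

variable {R : Type*} [CommRing R]

/-- The recursion satisfied by `runPoly true`, for an arbitrary sequence of length `N`. -/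
def foldStep (t : R) (N : ℕ) (f : ℕ → R) (a : ℕ) : R :=
  ∑ b ∈ Finset.range N, if b < a then t * f (N - 1 - b) else f b

theorem pow_succ_dvd_foldStep_add_reflect (t : R) (N k : ℕ) (f : ℕ → R)
    (hf : ∀ b < N, (1 + t) ^ k ∣ f b) (a : ℕ) (ha : a ≤ N) :
    (1 + t) ^ (k + 1) ∣ foldStep t N f a + foldStep t N f (N - a) := by
  have h : foldStep t N f (N - a) =
      ∑ b ∈ Finset.range N, if b < a then f (N - 1 - b) else t * f b := by
    rw [foldStep, ← Finset.sum_range_reflect]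
    refine Finset.sum_congr rfl fun b hb => ?_
    have hb := Finset.mem_range.1 hb
    have h1 : N - 1 - (N - 1 - b) = b := by omega
    rw [h1]
    split_ifs <;> first | rfl | omega
  rw [h, foldStep, ← Finset.sum_add_distrib]
  refine Finset.dvd_sum fun b hb => ?_
  have hb := Finset.mem_range.1 hb
  split_ifs
  · rw [show t * f (N - 1 - b) + f (N - 1 - b) = f (N - 1 - b) * (1 + t) by ring, pow_succ]
    exact mul_dvd_mul_right (hf _ (by omega)) _
  · rw [show f b + t * f b = f b * (1 + t) by ring, pow_succ]
    exact mul_dvd_mul_right (hf _ hb) _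

theorem pow_succ_dvd_sum_foldStep (t : R) (N k : ℕ) (f : ℕ → R)
    (hf : ∀ b < N, (1 + t) ^ k ∣ f b) :
    (1 + t) ^ (k + 1) ∣ ∑ a ∈ Finset.range (N + 1), foldStep t N f a := by
  have h1 : ∀ a, foldStep t N f a =
      (∑ b ∈ Finset.range N, if b < a then t * f (N - 1 - b) else 0) +
        ∑ b ∈ Finset.range N, if a ≤ b then f b else 0 := by
    intro a
    rw [foldStep, ← Finset.sum_add_distrib]
    refine Finset.sum_congr rfl fun b _ => ?_
    split_ifs <;> first | omega | simp
  have h2 : ∑ a ∈ Finset.range (N + 1),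
        (∑ b ∈ Finset.range N, if b < a then t * f (N - 1 - b) else 0) =
      ∑ a ∈ Finset.range (N + 1), ∑ b ∈ Finset.range N, if a ≤ b then t * f b else 0 := by
    rw [← Finset.sum_range_reflect]
    refine Finset.sum_congr rfl fun a ha => ?_
    rw [← Finset.sum_range_reflect]
    refine Finset.sum_congr rfl fun b hb => ?_
    have ha := Finset.mem_range.1 ha
    have hb := Finset.mem_range.1 hb
    have h3 : N - 1 - (N - 1 - b) = b := by omega
    rw [h3]
    split_ifs <;> first | rfl | omega
  simp only [h1]
  rw [Finset.sum_add_distrib, h2, ← Finset.sum_add_distrib]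
  refine Finset.dvd_sum fun a _ => ?_
  rw [← Finset.sum_add_distrib]
  refine Finset.dvd_sum fun b hb => ?_
  split_ifs
  · rw [show t * f b + f b = f b * (1 + t) by ring, pow_succ]
    exact mul_dvd_mul_right (hf _ (Finset.mem_range.1 hb)) _
  · simp

theorem pow_succ_dvd_foldStep (t : R) (N k : ℕ) (f : ℕ → R)
    (hf : ∀ b < N, (1 + t) ^ k ∣ f b)
    (hadd : ∀ b < N, (1 + t) ^ (k + 1) ∣ f b + f (N - 1 - b))
    (hsum : (1 + t) ^ (k + 1) ∣ ∑ b ∈ Finset.range N, f b) (a : ℕ) :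
    (1 + t) ^ (k + 1) ∣ foldStep t N f a := by
  have h : foldStep t N f a = (∑ b ∈ Finset.range N,
      if b < a then t * (f b + f (N - 1 - b)) - f b * (1 + t) else 0) +
        ∑ b ∈ Finset.range N, f b := by
    rw [foldStep, ← Finset.sum_add_distrib]
    refine Finset.sum_congr rfl fun b _ => ?_
    split_ifs <;> ring
  rw [h]
  refine dvd_add (Finset.dvd_sum fun b hb => ?_) hsum
  have hb := Finset.mem_range.1 hb
  split_ifs
  · refine dvd_sub (dvd_mul_of_dvd_right (hadd b hb) t) ?_
    rw [pow_succ]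
    exact mul_dvd_mul_right (hf b hb) _
  · simp

end Divisibility

open Polynomial in
theorem runPoly_true_succ (n a : ℕ) :
    runPoly true (n + 1) a = foldStep X (n + 1) (runPoly true n) a := by
  rw [runPoly, foldStep]
  refine Finset.sum_congr rfl fun b hb => ?_
  have hb := Finset.mem_range.1 hb
  rw [runPoly_not true n b (by omega)]
  simp

open Polynomial in
theorem pow_dvd_runPoly (k n : ℕ) (hk : 2 * k ≤ n) (a : ℕ) (ha : a ≤ n) :
    (1 + X : ℤ[X]) ^ k ∣ runPoly true n a := by
  induction k generalizing n a with
  | zero => simp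
  | succ k ih =>
    obtain ⟨m, rfl⟩ : ∃ m, n = m + 2 := ⟨n - 2, by omega⟩
    have hm : ∀ b < m + 1, (1 + X : ℤ[X]) ^ k ∣ runPoly true m b := fun b hb =>
      ih m (by omega) b (by omega)
    rw [runPoly_true_succ]
    refine pow_succ_dvd_foldStep X _ k _ (fun b hb => ih _ (by omega) b (by omega)) ?_ ?_ a
    · intro b hb
      rw [runPoly_true_succ, runPoly_true_succ]
      exact pow_succ_dvd_foldStep_add_reflect X (m + 1) k _ hm b (by omega)
    · simp only [runPoly_true_succ]
      exact pow_succ_dvd_sum_foldStep X (m + 1) k _ hm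

theorem T_divisible (n : ℕ) (hn : 2 ≤ n) :
    ((1 + Polynomial.X : Polynomial ℤ) ^ (n / 2)) ∣
      ∑ k ∈ Finset.range (n + 1),
        Polynomial.C (aCount n k : ℤ) * Polynomial.X ^ k := by
  obtain ⟨m, rfl⟩ : ∃ m, n = m + 2 := ⟨n - 2, by omega⟩
  rw [sum_aCount_eq_sum_runPoly (m + 1), show (m + 2) / 2 = m / 2 + 1 by omega]
  simp only [runPoly_true_succ]
  exact pow_succ_dvd_sum_foldStep Polynomial.X (m + 1) (m / 2) _
    fun b hb => pow_dvd_runPoly (m / 2) m (by omega) b (by omega)
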